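/- The complex matrix equation AX - XB = C has a unique solution if and only if A and B have no common eigenvalue. -/

import Mathlib

open Matrix

theorem aeval_mul_eq_mul_aeval_of_intertwine {R m n : Type*} [CommRing R]
    [Fintype m] [DecidableEq m] [Fintype n] [DecidableEq n]
    {A : Matrix m m R} {B : Matrix n n R} {X : Matrix m n R} (h : A * X = X * B)
    (p : Polynomial R) : Polynomial.aeval A p * X = X * Polynomial.aeval B p := by
  induction p using Polynomial.induction_on' with
  | add p q hp hq => simp only [map_add, Matrix.add_mul, Matrix.mul_add, hp, hq]
  | monomial k a =>
    have hk : A ^ k * X = X * B ^ k := by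
      induction k with
      | zero => simp
      | succ k ih => rw [pow_succ, pow_succ, Matrix.mul_assoc, h, ← Matrix.mul_assoc, ih,
          Matrix.mul_assoc]
    simp [Polynomial.aeval_monomial, ← Algebra.smul_def, hk]

theorem eq_zero_of_intertwine_of_isCoprime_charpoly {R m n : Type*} [CommRing R]
    [Fintype m] [DecidableEq m] [Fintype n] [DecidableEq n]
    {A : Matrix m m R} {B : Matrix n n R} (hAB : IsCoprime A.charpoly B.charpoly)
    {X : Matrix m n R} (h : A * X = X * B) : X = 0 := by
  obtain ⟨u, v, huv⟩ := hAB
  have key := aeval_mul_eq_mul_aeval_of_intertwine h (u * A.charpoly)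
  have hB : Polynomial.aeval B (u * A.charpoly) = 1 := by
    have := congrArg (Polynomial.aeval B) huv
    simpa only [map_add, map_mul, map_one, aeval_self_charpoly, mul_zero, add_zero] using this
  rw [hB, map_mul, aeval_self_charpoly] at key
  simpa using key.symm

theorem isCoprime_charpoly_of_disjoint_spectrum {K m n : Type*} [Field K] [IsAlgClosed K]
    [Fintype m] [DecidableEq m] [Fintype n] [DecidableEq n]
    {A : Matrix m m K} {B : Matrix n n K} (h : Disjoint (spectrum K A) (spectrum K B)) :
    IsCoprime A.charpoly B.charpoly := by
  rw [Polynomial.isCoprime_iff_aeval_ne_zero_of_isAlgClosed K K]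
  intro a
  by_contra! ha
  simp only [Polynomial.coe_aeval_eq_eval] at ha
  exact Set.disjoint_left.mp h (Matrix.mem_spectrum_iff_isRoot_charpoly.mpr ha.1)
    (Matrix.mem_spectrum_iff_isRoot_charpoly.mpr ha.2)

theorem exists_ne_zero_intertwine_of_mem_spectrum {K m n : Type*} [Field K]
    [Fintype m] [DecidableEq m] [Fintype n] [DecidableEq n]
    {A : Matrix m m K} {B : Matrix n n K} {a : K} (hA : a ∈ spectrum K A)
    (hB : a ∈ spectrum K B) : ∃ X : Matrix m n K, X ≠ 0 ∧ A * X = X * B := by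
  rw [spectrum.mem_iff, Matrix.isUnit_iff_isUnit_det, isUnit_iff_ne_zero, not_not] at hA hB
  obtain ⟨v, hv, hAv⟩ := Matrix.exists_mulVec_eq_zero_iff.mpr hA
  obtain ⟨w, hw, hBw⟩ := Matrix.exists_vecMul_eq_zero_iff.mpr hB
  rw [Matrix.sub_mulVec, sub_eq_zero, Algebra.algebraMap_eq_smul_one, Matrix.smul_mulVec,
    Matrix.one_mulVec] at hAv
  rw [Matrix.vecMul_sub, sub_eq_zero, Algebra.algebraMap_eq_smul_one, Matrix.vecMul_smul,
    Matrix.vecMul_one] at hBw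
  obtain ⟨i, hi⟩ := Function.ne_iff.mp hv
  obtain ⟨j, hj⟩ := Function.ne_iff.mp hw
  refine ⟨Matrix.vecMulVec v w, fun h => mul_ne_zero hi hj (congrFun (congrFun h i) j), ?_⟩
  rw [Matrix.mul_vecMulVec, Matrix.vecMulVec_mul, ← hAv, ← hBw, Matrix.smul_vecMulVec,
    Matrix.vecMulVec_smul]

theorem sylvester_unique_solution {m n : ℕ}
    (A : Matrix (Fin m) (Fin m) ℂ) (B : Matrix (Fin n) (Fin n) ℂ)
    (C : Matrix (Fin m) (Fin n) ℂ) :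
    (∃! X : Matrix (Fin m) (Fin n) ℂ, A * X - X * B = C) ↔
    Disjoint (spectrum ℂ A) (spectrum ℂ B) := by
  constructor
  · rintro ⟨X, hX, huniq⟩
    refine Set.disjoint_left.mpr fun a hA hB => ?_
    obtain ⟨Y, hY, hAY⟩ := exists_ne_zero_intertwine_of_mem_spectrum hA hB
    refine hY (add_eq_left.mp (huniq (X + Y) ?_))
    simp only [Matrix.mul_add, Matrix.add_mul, hAY, ← hX]
    abel
  · intro h
    let S : Matrix (Fin m) (Fin n) ℂ →ₗ[ℂ] Matrix (Fin m) (Fin n) ℂ :=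
      { toFun := fun X => A * X - X * B
        map_add' := fun X Y => by
          simp only [Matrix.mul_add, Matrix.add_mul]
          abel
        map_smul' := fun c X => by simp [smul_sub] }
    have hinj : Function.Injective S := (injective_iff_map_eq_zero S).mpr fun X hX =>
      eq_zero_of_intertwine_of_isCoprime_charpoly
        (isCoprime_charpoly_of_disjoint_spectrum h) (sub_eq_zero.mp hX)
    exact Function.Bijective.existsUnique
      ⟨hinj, LinearMap.injective_iff_surjective.mp hinj⟩ C
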